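/- (Discrete stability of the leapfrog finite element scheme, Theorem 3.1.) Let ε₀, μ₀, τ₀, σ₀, C_in, C_tr, T_fin > 0 be given and set C_v = 1/√(ε₀μ₀). Then there exists a constant C* > 0, independent of the time step τ and mesh size h (depending only on ε₀, μ₀, τ₀, σ₀, C_in, C_tr, T_fin), with the following property. Let V, U, Z be real inner product spaces, let B : V → U and T : V → Z be linear maps satisfying the inverse estimate ‖Bφ‖_U ≤ C_in·h^{−1}·‖φ‖_V and the trace inequality ‖Tφ‖_Z ≤ C_tr·h^{−1/2}·‖φ‖_V for all φ ∈ V, let N_t be a positive integer and τ = T_fin/N_t, and suppose τ satisfies the CFL condition τ ≤ min( 1, h/(2 C_in C_v), h√(ε₀τ₀)/(2 C_tr √σ₀), h√τ₀/(√2 C_in C_v), h τ₀/(C_in C_v) ). Suppose the sequences E⁰, E¹, …, E^{N_t} ∈ V, H^{1/2}, H^{3/2}, …, H^{N_t−1/2} ∈ U and given sources K⁰, K¹, …, K^{N_t} ∈ U satisfy, for every 1 ≤ n ≤ N_t − 1: (a) ε₀⟨(E^{n+1} − 2Eⁿ + E^{n−1})/τ², φ⟩ + (ε₀/τ₀)⟨(E^{n+1}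 − E^{n−1})/(2τ), φ⟩ + (1/μ₀)⟨BEⁿ, Bφ⟩ = (1/τ₀)⟨(H^{n+1/2} + H^{n−1/2})/2, Bφ⟩ − (σ₀/τ₀)⟨TEⁿ, Tφ⟩ − (1/μ₀)⟨Kⁿ, Bφ⟩ for all φ ∈ V, and (b) μ₀⟨(H^{n+1/2} − H^{n−1/2})/τ, ψ⟩ = −⟨BEⁿ, ψ⟩ − ⟨Kⁿ, ψ⟩ for all ψ ∈ U. Define for 0 ≤ m ≤ N_t − 1 the discrete energy ENG_m = ε₀‖(E^{m+1} − E^m)/τ‖²_V + (1/(2μ₀))(‖BE^{m+1}‖²_U + ‖BE^m‖²_U) + μ₀‖H^{m+1/2}‖²_U + (σ₀/(2τ₀))(‖TE^{m+1}‖²_Z + ‖TE^m‖²_Z) + (τ/(4μ₀τ₀))(‖BE^{m+1}‖²_U + ‖BE^m‖²_U). Then for every 1 ≤ m ≤ N_t − 1: ENG_m ≤ C*·[ ENG₀ + ‖K⁰‖²_U + ‖K¹‖²_U + τ·Σ_{n=1}^{m} ( ‖Kⁿ‖²_U + ‖(K^{n+1} − K^{n−1})/(2τ)‖²_U ) ].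 -/

import Mathlib

open scoped RealInnerProductSpace

universe u v w


section helpers

variable {V : Type u} {U : Type v} {Z : Type w}
  [NormedAddCommGroup V] [InnerProductSpace ℝ V]
  [NormedAddCommGroup U] [InnerProductSpace ℝ U]
  [NormedAddCommGroup Z] [InnerProductSpace ℝ Z]

/-- Crude one-step bound. -/
lemma lf_crude (ε₀ μ₀ τ₀ σ₀ β g : ℝ)
    (hε₀ : 0 < ε₀) (hμ₀ : 0 < μ₀) (hτ₀ : 0 < τ₀) (hσ₀ : 0 < σ₀) (hβ : 0 < β) (hg : 0 < g) :
    ∃ C : ℝ, 1 ≤ C ∧ ∀ (V : Type u) (U : Type v) (Z : Type w)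
      [NormedAddCommGroup V] [InnerProductSpace ℝ V]
      [NormedAddCommGroup U] [InnerProductSpace ℝ U]
      [NormedAddCommGroup Z] [InnerProductSpace ℝ Z]
      (τ R : ℝ) (δ d : V) (X P Q h0 h1 k0 k1 D : U) (Y p q : Z),
      0 < τ → τ ≤ 1 → 0 ≤ R →
      τ * ‖P‖ ≤ β * ‖δ‖ → τ * ‖Q‖ ≤ β * ‖d‖ →
      τ * ‖p‖ ≤ g * ‖δ‖ → τ * ‖q‖ ≤ g * ‖d‖ →
      ε₀ * (‖δ‖^2 - ‖d‖^2) + (ε₀ * τ / (2 * τ₀)) * ‖δ + d‖^2 + (τ / μ₀) * ⟪X, P + Q⟫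
        = (τ / (2 * τ₀)) * ⟪h1 + h0, P + Q⟫ - (σ₀ * τ / τ₀) * ⟪Y, p + q⟫
          - (τ / μ₀) * ⟪k1, P + Q⟫ →
      h1 = h0 - (τ / μ₀) • (X + k1) →
      ‖d‖ ≤ R → ‖X‖ ≤ R → ‖h0‖ ≤ R → ‖Y‖ ≤ R → ‖k0‖ ≤ R → ‖k1‖ ≤ R → ‖D‖ ≤ R →
      ‖δ‖ ≤ C * R ∧ ‖X + τ • P‖ ≤ C * R ∧ ‖h1‖ ≤ C * R ∧ ‖Y + τ • p‖ ≤ C * R ∧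
        ‖k0 + (2 * τ) • D‖ ≤ C * R := by
  set ch : ℝ := 1 + 2 / μ₀ with hch
  set w : ℝ := β / μ₀ + (β / (2 * τ₀)) * (ch + 1) + σ₀ * g / τ₀ + β / μ₀ with hw
  set cd : ℝ := 1 + w / ε₀ with hcd
  have hch0 : 0 < ch := by positivity
  have hw0 : 0 < w := by positivity
  have hcd0 : 0 < cd := by positivity
  have hbc : 0 < β * cd := by positivity
  have hgc : 0 < g * cd := by positivity
  refine ⟨3 + ch + cd + β * cd + g * cd, by linarith, ?_⟩
  intro V U Z _ _ _ _ _ _ τ R δ d X P Q h0 h1 k0 k1 D Y p q hτ hτ1 hR hP hQ hp hq hA hB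
    hd hX hh0 hY hk0 hk1 hD
  have hh1 : ‖h1‖ ≤ ch * R := by
    have e1 : ‖h1‖ ≤ ‖h0‖ + (τ / μ₀) * ‖X + k1‖ := by
      rw [hB]
      refine (norm_sub_le _ _).trans ?_
      rw [norm_smul, Real.norm_of_nonneg (by positivity)]
    have e2 : (τ / μ₀) * ‖X + k1‖ ≤ (1 / μ₀) * (R + R) := by
      gcongr
      exact (norm_add_le _ _).trans (add_le_add hX hk1)
    have e3 : ch * R = R + (1 / μ₀) * (R + R) := by rw [hch]; ring
    linarith
  have hPQ : τ * ‖P + Q‖ ≤ β * (‖δ‖ + ‖d‖) := by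
    have := mul_le_mul_of_nonneg_left (norm_add_le P Q) hτ.le
    linarith
  have hpq : τ * ‖p + q‖ ≤ g * (‖δ‖ + ‖d‖) := by
    have := mul_le_mul_of_nonneg_left (norm_add_le p q) hτ.le
    linarith
  set s : ℝ := ‖δ‖ + ‖d‖ with hs
  have hs0 : 0 ≤ s := by positivity
  have key : ∀ (W : U) (c : ℝ), ‖W‖ ≤ c * R → 0 ≤ c → τ * |⟪W, P + Q⟫| ≤ c * β * R * s := by
    intro W c hW hc
    calc τ * |⟪W, P + Q⟫| ≤ τ * (‖W‖ * ‖P + Q‖) := by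
          gcongr; exact abs_real_inner_le_norm _ _
      _ = ‖W‖ * (τ * ‖P + Q‖) := by ring
      _ ≤ (c * R) * (β * s) := by gcongr
      _ = _ := by ring
  have keyZ : τ * |⟪Y, p + q⟫| ≤ g * R * s := by
    calc τ * |⟪Y, p + q⟫| ≤ τ * (‖Y‖ * ‖p + q‖) := by
          gcongr; exact abs_real_inner_le_norm _ _
      _ = ‖Y‖ * (τ * ‖p + q‖) := by ring
      _ ≤ R * (g * s) := by gcongr
      _ = _ := by ring
  have k1' := key X 1 (by linarith) (by norm_num)
  have k2' := key k1 1 (by linarith) (by norm_num)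
  have k3' := key (h1 + h0) (ch + 1) ((norm_add_le _ _).trans (by linarith)) (by positivity)
  have main : ε₀ * (‖δ‖^2 - ‖d‖^2) ≤ w * R * s := by
    have a1 : -((τ / μ₀) * ⟪X, P + Q⟫) ≤ (1 / μ₀) * (1 * β * R * s) := by
      calc _ = (1 / μ₀) * (τ * (-⟪X, P + Q⟫)) := by ring
        _ ≤ (1 / μ₀) * (τ * |⟪X, P + Q⟫|) := by gcongr; exact neg_le_abs _
        _ ≤ _ := by gcongr
    have a2 : -((τ / μ₀) * ⟪k1, P + Q⟫) ≤ (1 / μ₀) * (1 * β * R * s) := by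
      calc _ = (1 / μ₀) * (τ * (-⟪k1, P + Q⟫)) := by ring
        _ ≤ (1 / μ₀) * (τ * |⟪k1, P + Q⟫|) := by gcongr; exact neg_le_abs _
        _ ≤ _ := by gcongr
    have a3 : ((τ / (2 * τ₀)) * ⟪h1 + h0, P + Q⟫) ≤ (1 / (2 * τ₀)) * ((ch + 1) * β * R * s) := by
      calc _ = (1 / (2 * τ₀)) * (τ * (⟪h1 + h0, P + Q⟫)) := by ring
        _ ≤ (1 / (2 * τ₀)) * (τ * |⟪h1 + h0, P + Q⟫|) := by gcongr; exact le_abs_self _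
        _ ≤ _ := by gcongr
    have a4 : -((σ₀ * τ / τ₀) * ⟪Y, p + q⟫) ≤ (σ₀ / τ₀) * (g * R * s) := by
      calc _ = (σ₀ / τ₀) * (τ * (-⟪Y, p + q⟫)) := by ring
        _ ≤ (σ₀ / τ₀) * (τ * |⟪Y, p + q⟫|) := by gcongr; exact neg_le_abs _
        _ ≤ _ := by gcongr
    have a5 : 0 ≤ (ε₀ * τ / (2 * τ₀)) * ‖δ + d‖^2 := by positivity
    have a6 : w * R * s = (1 / μ₀) * (1 * β * R * s) + (1 / μ₀) * (1 * β * R * s)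
        + (1 / (2 * τ₀)) * ((ch + 1) * β * R * s) + (σ₀ / τ₀) * (g * R * s) := by
      rw [hw]; ring
    linarith
  have hδ : ‖δ‖ ≤ cd * R := by
    by_contra hcon
    push Not at hcon
    have hcR : 0 ≤ cd * R := by positivity
    have hspos : 0 < s := by
      have := norm_nonneg d
      linarith
    have e1 : ε₀ * (‖δ‖ - ‖d‖) * s ≤ w * R * s := by
      have : ε₀ * (‖δ‖ - ‖d‖) * s = ε₀ * (‖δ‖^2 - ‖d‖^2) := by rw [hs]; ring
      linarith
    have e2 := le_of_mul_le_mul_right e1 hspos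
    have e3 : ε₀ * (cd * R) = ε₀ * R + w * R := by rw [hcd]; field_simp
    have e4 : ε₀ * (cd * R) < ε₀ * ‖δ‖ := by gcongr
    have e5 : ε₀ * ‖d‖ ≤ ε₀ * R := by gcongr
    linarith
  have hchR : 0 ≤ ch * R := by positivity
  have hcdR : 0 ≤ cd * R := by positivity
  have hbR : 0 ≤ β * cd * R := by positivity
  have hgR : 0 ≤ g * cd * R := by positivity
  have expand : (3 + ch + cd + β * cd + g * cd) * R
    = 3 * R + ch * R + cd * R + β * cd * R + g * cd * R := by ring
  rw [expand]
  refine ⟨by linarith, ?_, by linarith, ?_, ?_⟩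
  · have e1 := norm_add_le X (τ • P)
    rw [norm_smul, Real.norm_of_nonneg hτ.le] at e1
    have e2 : β * ‖δ‖ ≤ β * (cd * R) := by gcongr
    linarith
  · have e1 := norm_add_le Y (τ • p)
    rw [norm_smul, Real.norm_of_nonneg hτ.le] at e1
    have e2 : g * ‖δ‖ ≤ g * (cd * R) := by gcongr
    linarith
  · have e1 := norm_add_le k0 ((2 * τ) • D)
    rw [norm_smul, Real.norm_of_nonneg (by positivity)] at e1
    have e2 : 2 * τ * ‖D‖ ≤ 2 * 1 * R := by gcongr
    linarith

/-- Modified energy. `x = B E^{n+1}`, `y = B E^n`, `P = B δ`. -/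
noncomputable def lfPhi (ε₀ μ₀ τ₀ σ₀ τ : ℝ) (δ : V) (x y P a k k' : U) (z z' : Z) : ℝ :=
  ε₀ * ‖δ‖^2 + (1 / (2 * μ₀)) * (‖x‖^2 + ‖y‖^2 - τ^2 * ‖P‖^2)
    + (σ₀ / (2 * τ₀)) * (‖z‖^2 + ‖z'‖^2)
    - (1 / τ₀) * ⟪a, x + y⟫ + (1 / μ₀) * (⟪k, x⟫ + ⟪k', y⟫)
    + (4 * μ₀ / τ₀^2 + 1) * ‖a‖^2 + (2 / μ₀ + 1) * (‖k'‖^2 + ‖k‖^2)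

/-- Reference energy. -/
noncomputable def lfA (δ : V) (x y a k k' : U) (z z' : Z) : ℝ :=
  ‖δ‖^2 + ‖x‖^2 + ‖y‖^2 + ‖a‖^2 + ‖z‖^2 + ‖z'‖^2 + ‖k'‖^2 + ‖k‖^2

lemma lf_young (c t : ℝ) (hc : 0 < c) (a b : U) : |t * ⟪a, b⟫| ≤ c * ‖b‖^2 + t^2 / (4 * c) * ‖a‖^2 := by
  have h1 : |t * ⟪a, b⟫| ≤ |t| * (‖a‖ * ‖b‖) := by
    rw [abs_mul]; gcongr; exact abs_real_inner_le_norm _ _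
  have h2 : c * ‖b‖^2 + t^2 / (4 * c) * ‖a‖^2 - |t| * (‖a‖ * ‖b‖)
      = c * (‖b‖ - |t| / (2 * c) * ‖a‖)^2 := by
    rw [← sq_abs t]; field_simp; ring
  have h3 : 0 ≤ c * (‖b‖ - |t| / (2 * c) * ‖a‖)^2 := by positivity
  linarith

lemma lf_lower (ε₀ μ₀ τ₀ σ₀ β : ℝ)
    (hε₀ : 0 < ε₀) (hμ₀ : 0 < μ₀) (hτ₀ : 0 < τ₀) (hσ₀ : 0 < σ₀) (hβ : 0 < β)
    (hβ2 : β^2 = ε₀ * μ₀ / 4) :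
    ∃ c : ℝ, 0 < c ∧ ∀ (V : Type u) (U : Type v) (Z : Type w)
      [NormedAddCommGroup V] [InnerProductSpace ℝ V]
      [NormedAddCommGroup U] [InnerProductSpace ℝ U]
      [NormedAddCommGroup Z] [InnerProductSpace ℝ Z]
      (τ : ℝ) (δ : V) (x y P a k k' : U) (z z' : Z), 0 < τ → τ * ‖P‖ ≤ β * ‖δ‖ →
      c * lfA δ x y a k k' z z' ≤ lfPhi ε₀ μ₀ τ₀ σ₀ τ δ x y P a k k' z z' := by
  set c := min (ε₀ / 2) (min (1 / (4 * μ₀)) (min (σ₀ / (2 * τ₀)) 1)) with hc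
  have c1 : c ≤ ε₀ / 2 := min_le_left _ _
  have c2 : c ≤ 1 / (4 * μ₀) := (min_le_right _ _).trans (min_le_left _ _)
  have c3 : c ≤ σ₀ / (2 * τ₀) :=
    (min_le_right _ _).trans ((min_le_right _ _).trans (min_le_left _ _))
  have c4 : c ≤ 1 := (min_le_right _ _).trans ((min_le_right _ _).trans (min_le_right _ _))
  have c0 : 0 < c := by
    rw [hc]; positivity
  refine ⟨c, c0, ?_⟩
  intro V U Z _ _ _ _ _ _ τ δ x y P a k k' z z' hτ hP
  have hP2 : τ^2 * ‖P‖^2 ≤ (ε₀ * μ₀ / 4) * ‖δ‖^2 := by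
    have : (τ * ‖P‖)^2 ≤ (β * ‖δ‖)^2 := by gcongr
    rw [mul_pow, mul_pow, hβ2] at this
    exact this
  have hP3 : (1 / (2 * μ₀)) * (τ^2 * ‖P‖^2) ≤ (ε₀ / 8) * ‖δ‖^2 := by
    calc _ ≤ (1 / (2 * μ₀)) * ((ε₀ * μ₀ / 4) * ‖δ‖^2) := by gcongr
      _ = _ := by field_simp; ring
  have y1 := (abs_le.mp (lf_young (1 / (8 * μ₀)) (1 / τ₀) (by positivity) a x)).2
  have y2 := (abs_le.mp (lf_young (1 / (8 * μ₀)) (1 / τ₀) (by positivity) a y)).2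
  have y3 := (abs_le.mp (lf_young (1 / (8 * μ₀)) (1 / μ₀) (by positivity) k x)).1
  have y4 := (abs_le.mp (lf_young (1 / (8 * μ₀)) (1 / μ₀) (by positivity) k' y)).1
  have t1 : (1 / τ₀)^2 / (4 * (1 / (8 * μ₀))) = 2 * μ₀ / τ₀^2 := by field_simp; ring
  have t2 : (1 / μ₀)^2 / (4 * (1 / (8 * μ₀))) = 2 / μ₀ := by field_simp; ring
  rw [t1] at y1 y2
  rw [t2] at y3 y4
  have m1 : c * ‖δ‖^2 ≤ ε₀ / 2 * ‖δ‖^2 := by gcongr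
  have m1' : 0 ≤ ε₀ * ‖δ‖^2 := by positivity
  have m2 : c * ‖x‖^2 ≤ 1 / (4 * μ₀) * ‖x‖^2 := by gcongr
  have m3 : c * ‖y‖^2 ≤ 1 / (4 * μ₀) * ‖y‖^2 := by gcongr
  have m4 : c * ‖z‖^2 ≤ σ₀ / (2 * τ₀) * ‖z‖^2 := by gcongr
  have m5 : c * ‖z'‖^2 ≤ σ₀ / (2 * τ₀) * ‖z'‖^2 := by gcongr
  have m6 : c * ‖a‖^2 ≤ 1 * ‖a‖^2 := by gcongr
  have m7 : c * ‖k‖^2 ≤ 1 * ‖k‖^2 := by gcongr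
  have m8 : c * ‖k'‖^2 ≤ 1 * ‖k'‖^2 := by gcongr
  unfold lfA lfPhi
  rw [inner_add_right]
  have r1 : 1 / (2 * μ₀) * (‖x‖^2 + ‖y‖^2 - τ^2 * ‖P‖^2)
    = 1 / (4 * μ₀) * ‖x‖^2 + 1 / (4 * μ₀) * ‖y‖^2 + 2 * (1 / (8 * μ₀) * ‖x‖^2)
      + 2 * (1 / (8 * μ₀) * ‖y‖^2) - 1 / (2 * μ₀) * (τ^2 * ‖P‖^2) := by field_simp; ring
  have r2 : 4 * μ₀ / τ₀^2 * ‖a‖^2 = 2 * (2 * μ₀ / τ₀^2 * ‖a‖^2) := by ring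
  rw [r1]
  linarith

lemma lf_upper (ε₀ μ₀ τ₀ σ₀ : ℝ)
    (hε₀ : 0 < ε₀) (hμ₀ : 0 < μ₀) (hτ₀ : 0 < τ₀) (hσ₀ : 0 < σ₀) :
    ∃ c : ℝ, 0 < c ∧ ∀ (V : Type u) (U : Type v) (Z : Type w)
      [NormedAddCommGroup V] [InnerProductSpace ℝ V]
      [NormedAddCommGroup U] [InnerProductSpace ℝ U]
      [NormedAddCommGroup Z] [InnerProductSpace ℝ Z]
      (τ : ℝ) (δ : V) (x y P a k k' : U) (z z' : Z),
      lfPhi ε₀ μ₀ τ₀ σ₀ τ δ x y P a k k' z z' ≤ c * lfA δ x y a k k' z z' := by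
  have q1 : 0 < 1 / (2 * μ₀) := by positivity
  have q2 : 0 < σ₀ / (2 * τ₀) := by positivity
  have q3 : 0 < 1 / τ₀ := by positivity
  have q4 : 0 < 1 / μ₀ := by positivity
  have q5 : 0 < 4 * μ₀ / τ₀^2 + 1 := by positivity
  have q6 : 0 < 2 / μ₀ + 1 := by positivity
  refine ⟨ε₀ + 1 / (2 * μ₀) + σ₀ / (2 * τ₀) + 1 / τ₀ + 1 / μ₀ + (4 * μ₀ / τ₀^2 + 1)
    + (2 / μ₀ + 1), by positivity, ?_⟩
  intro V U Z _ _ _ _ _ _ τ δ x y P a k k' z z'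
  have A0 : ∀ s : ℝ, s ≤ lfA δ x y a k k' z z' → ∀ t : ℝ, 0 < t →
    t * s ≤ t * lfA δ x y a k k' z z' := fun s hs t ht => by gcongr
  have cs : ∀ a b : U, ⟪a, b⟫ ≤ (‖a‖^2 + ‖b‖^2) / 2 := fun a b => by
    have := real_inner_le_norm a b
    nlinarith [sq_nonneg (‖a‖ - ‖b‖)]
  have cs' : ∀ a b : U, -⟪a, b⟫ ≤ (‖a‖^2 + ‖b‖^2) / 2 := fun a b => by
    have := cs (-a) b
    simpa using this
  have n1 := sq_nonneg ‖δ‖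
  have n2 := sq_nonneg ‖x‖
  have n3 := sq_nonneg ‖y‖
  have n4 := sq_nonneg ‖a‖
  have n5 := sq_nonneg ‖z‖
  have n6 := sq_nonneg ‖z'‖
  have n7 := sq_nonneg ‖k‖
  have n8 := sq_nonneg ‖k'‖
  have n9 : 0 ≤ τ^2 * ‖P‖^2 := by positivity
  have b1 := A0 (‖δ‖^2) (by unfold lfA; linarith) ε₀ hε₀
  have b2 := A0 (‖x‖^2 + ‖y‖^2 - τ^2 * ‖P‖^2) (by unfold lfA; linarith) _ q1
  have b3 := A0 (‖z‖^2 + ‖z'‖^2) (by unfold lfA; linarith) _ q2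
  have b4 := A0 (-⟪a, x + y⟫) (by
    rw [inner_add_right]; unfold lfA; linarith [cs' a x, cs' a y]) _ q3
  have b5 := A0 (⟪k, x⟫ + ⟪k', y⟫) (by unfold lfA; linarith [cs k x, cs k' y]) _ q4
  have b6 := A0 (‖a‖^2) (by unfold lfA; linarith) _ q5
  have b7 := A0 (‖k'‖^2 + ‖k‖^2) (by unfold lfA; linarith) _ q6
  unfold lfPhi
  linarith

/-- One step estimate. -/
lemma lf_step (ε₀ μ₀ τ₀ σ₀ β g : ℝ)
    (hε₀ : 0 < ε₀) (hμ₀ : 0 < μ₀) (hτ₀ : 0 < τ₀) (hσ₀ : 0 < σ₀) (hβ : 0 < β) (hg : 0 < g) :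
    ∃ L : ℝ, 0 < L ∧ ∀ (V : Type u) (U : Type v) (Z : Type w)
      [NormedAddCommGroup V] [InnerProductSpace ℝ V]
      [NormedAddCommGroup U] [InnerProductSpace ℝ U]
      [NormedAddCommGroup Z] [InnerProductSpace ℝ Z]
      (τ : ℝ) (δ d : V) (X P Q h0 h1 k0 k1 D : U) (Y p q : Z),
      0 < τ → τ ≤ 1 →
      τ * ‖P‖ ≤ β * ‖δ‖ → τ * ‖Q‖ ≤ β * ‖d‖ →
      τ * ‖p‖^2 ≤ g^2 * ‖δ‖^2 → τ * ‖q‖^2 ≤ g^2 * ‖d‖^2 →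
      ε₀ * (‖δ‖^2 - ‖d‖^2) + (ε₀ * τ / (2 * τ₀)) * ‖δ + d‖^2 + (τ / μ₀) * ⟪X, P + Q⟫
        = (τ / (2 * τ₀)) * ⟪h1 + h0, P + Q⟫ - (σ₀ * τ / τ₀) * ⟪Y, p + q⟫
          - (τ / μ₀) * ⟪k1, P + Q⟫ →
      h1 = h0 - (τ / μ₀) • (X + k1) →
      lfPhi ε₀ μ₀ τ₀ σ₀ τ δ (X + τ • P) X P h1 k1 (k0 + (2 * τ) • D) (Y + τ • p) Y
        ≤ lfPhi ε₀ μ₀ τ₀ σ₀ τ d X (X - τ • Q) Q h0 k0 k1 Y (Y - τ • q)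
          + L * τ * (lfA d X (X - τ • Q) h0 k0 k1 Y (Y - τ • q) + (‖k1‖^2 + ‖D‖^2)) := by
  obtain ⟨C, hC1, hC⟩ := lf_crude.{u, v, w} ε₀ μ₀ τ₀ σ₀ β g hε₀ hμ₀ hτ₀ hσ₀ hβ hg
  have hC0 : 0 < C := by linarith
  refine ⟨C^2 * (σ₀ * g^2 / (2 * τ₀) + 4 / (τ₀ * μ₀) + 2 / μ₀
    + (4 * μ₀ / τ₀^2 + 1) * (4 / μ₀) + 4 * (2 / μ₀ + 1)), by positivity, ?_⟩
  intro V U Z _ _ _ _ _ _ τ δ d X P Q h0 h1 k0 k1 D Y p q hτ hτ1 hP hQ hp hq hA hB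
  set S := lfA d X (X - τ • Q) h0 k0 k1 Y (Y - τ • q) + (‖k1‖^2 + ‖D‖^2) with hS
  have hS0 : 0 ≤ S := by rw [hS]; unfold lfA; positivity
  set R := Real.sqrt S with hR
  have hR0 : 0 ≤ R := Real.sqrt_nonneg _
  have hRS : R^2 = S := Real.sq_sqrt hS0
  have toT : ∀ (a : V) (b : Z), τ * ‖b‖^2 ≤ g^2 * ‖a‖^2 → τ * ‖b‖ ≤ g * ‖a‖ := by
    intro a b hab
    apply le_of_sq_le_sq _ (by positivity)
    have : τ * (τ * ‖b‖^2) ≤ 1 * (τ * ‖b‖^2) := by gcongr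
    nlinarith
  have nn : ∀ t : ℝ, t^2 ≤ S → t ≤ R := fun t ht => Real.le_sqrt_of_sq_le ht
  have n1 := sq_nonneg ‖d‖
  have n2 := sq_nonneg ‖X‖
  have n3 := sq_nonneg ‖X - τ • Q‖
  have n4 := sq_nonneg ‖h0‖
  have n5 := sq_nonneg ‖Y‖
  have n6 := sq_nonneg ‖Y - τ • q‖
  have n7 := sq_nonneg ‖k0‖
  have n8 := sq_nonneg ‖k1‖
  have n9 := sq_nonneg ‖D‖
  have rd : ‖d‖ ≤ R := nn _ (by rw [hS]; unfold lfA; linarith)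
  have rX : ‖X‖ ≤ R := nn _ (by rw [hS]; unfold lfA; linarith)
  have rX' : ‖X - τ • Q‖ ≤ R := nn _ (by rw [hS]; unfold lfA; linarith)
  have rh0 : ‖h0‖ ≤ R := nn _ (by rw [hS]; unfold lfA; linarith)
  have rY : ‖Y‖ ≤ R := nn _ (by rw [hS]; unfold lfA; linarith)
  have rk0 : ‖k0‖ ≤ R := nn _ (by rw [hS]; unfold lfA; linarith)
  have rk1 : ‖k1‖ ≤ R := nn _ (by rw [hS]; unfold lfA; linarith)
  have rD : ‖D‖ ≤ R := nn _ (by rw [hS]; unfold lfA; linarith)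
  obtain ⟨cδ, cX, ch1, cY, ck2⟩ := hC V U Z τ R δ d X P Q h0 h1 k0 k1 D Y p q hτ hτ1 hR0 hP hQ
    (toT _ _ hp) (toT _ _ hq) hA hB rd rX rh0 rY rk0 rk1 rD
  have RC : R ≤ C * R := le_mul_of_one_le_left hR0 hC1
  set k2 := k0 + (2 * τ) • D with hk2
  set x2 := X + τ • P with hx2
  set x0 := X - τ • Q with hx0
  have ident : lfPhi ε₀ μ₀ τ₀ σ₀ τ δ x2 X P h1 k1 k2 (Y + τ • p) Y
      - lfPhi ε₀ μ₀ τ₀ σ₀ τ d X x0 Q h0 k0 k1 Y (Y - τ • q)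
      = -(ε₀ * τ / (2 * τ₀)) * ‖δ + d‖^2 + σ₀ / (2 * τ₀) * τ^2 * (‖p‖^2 - ‖q‖^2)
        + τ / (2 * τ₀ * μ₀) * ⟪X + k1, x2 + X + (X + x0)⟫
        + 2 * τ / μ₀ * ⟪D, X⟫
        - (4 * μ₀ / τ₀^2 + 1) * (τ / μ₀) * ⟪X + k1, h1 + h0⟫
        + (2 / μ₀ + 1) * (2 * τ) * ⟪D, k2 + k0⟫ := by
    have s1 : ‖h1‖^2 - ‖h0‖^2 = - (τ / μ₀) * ⟪X + k1, h1 + h0⟫ := by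
      have : ‖h1‖^2 - ‖h0‖^2 = ⟪h1 - h0, h1 + h0⟫ := by
        simp only [← real_inner_self_eq_norm_sq, inner_add_right, inner_sub_left]
        rw [real_inner_comm h0 h1]; ring
      rw [this]
      have e : h1 - h0 = -((τ / μ₀) • (X + k1)) := by rw [hB]; abel
      rw [e, inner_neg_left, real_inner_smul_left]; ring
    have s2 : ‖k2‖^2 - ‖k0‖^2 = (2 * τ) * ⟪D, k2 + k0⟫ := by
      have : ‖k2‖^2 - ‖k0‖^2 = ⟪k2 - k0, k2 + k0⟫ := by
        simp only [← real_inner_self_eq_norm_sq, inner_add_right, inner_sub_left]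
        rw [real_inner_comm k0 k2]; ring
      rw [this]
      have e : k2 - k0 = (2 * τ) • D := by rw [hk2]; abel
      rw [e, real_inner_smul_left]
    have s3 : ⟪h1, x2 + X⟫ - ⟪h0, X + x0⟫
        = τ / 2 * ⟪h1 + h0, P + Q⟫ - (τ / (2 * μ₀)) * ⟪X + k1, x2 + X + (X + x0)⟫ := by
      have e : (τ / μ₀) * ⟪X + k1, x2 + X + (X + x0)⟫ = - ⟪h1 - h0, x2 + X + (X + x0)⟫ := by
        have e : h1 - h0 = -((τ / μ₀) • (X + k1)) := by rw [hB]; abel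
        rw [e, inner_neg_left, real_inner_smul_left]; ring
      have e' : (τ / (2 * μ₀)) * ⟪X + k1, x2 + X + (X + x0)⟫
          = (1 / 2) * ((τ / μ₀) * ⟪X + k1, x2 + X + (X + x0)⟫) := by ring
      rw [e', e, hx2, hx0]
      simp only [inner_add_right, inner_add_left, inner_sub_left, inner_sub_right,
        real_inner_smul_right]
      ring
    have s4 : ‖x2‖^2 - ‖x0‖^2 - τ^2 * ‖P‖^2 + τ^2 * ‖Q‖^2 = 2 * τ * ⟪X, P + Q⟫ := by
      rw [hx2, hx0, norm_add_sq_real, norm_sub_sq_real, norm_smul, norm_smul,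
        Real.norm_of_nonneg hτ.le, real_inner_smul_right, real_inner_smul_right, inner_add_right]
      ring
    have s5 : ‖Y + τ • p‖^2 - ‖Y - τ • q‖^2
        = 2 * τ * ⟪Y, p + q⟫ + τ^2 * (‖p‖^2 - ‖q‖^2) := by
      rw [norm_add_sq_real, norm_sub_sq_real, norm_smul, norm_smul,
        Real.norm_of_nonneg hτ.le, real_inner_smul_right, real_inner_smul_right, inner_add_right]
      ring
    have s6 : (⟪k1, x2⟫ + ⟪k2, X⟫) - (⟪k0, X⟫ + ⟪k1, x0⟫)
        = τ * ⟪k1, P + Q⟫ + 2 * τ * ⟪D, X⟫ := by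
      rw [hx2, hx0, hk2]
      simp only [inner_add_right, inner_add_left, inner_sub_right,
        real_inner_smul_right, real_inner_smul_left]
      ring
    unfold lfPhi
    linear_combination hA + (4 * μ₀ / τ₀^2 + 1) * s1 + (2 / μ₀ + 1) * s2 - (1 / τ₀) * s3
      + (1 / (2 * μ₀)) * s4 + (σ₀ / (2 * τ₀)) * s5 + (1 / μ₀) * s6
  have ip : ∀ (a b : U) (s t : ℝ), ‖a‖ ≤ s * (C * R) → ‖b‖ ≤ t * (C * R) → 0 ≤ s → 
      |⟪a, b⟫| ≤ s * t * C^2 * S := by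
    intro a b s t ha hb hs
    calc |⟪a, b⟫| ≤ ‖a‖ * ‖b‖ := abs_real_inner_le_norm _ _
      _ ≤ (s * (C * R)) * (t * (C * R)) := by gcongr
      _ = s * t * C^2 * S := by rw [← hRS]; ring
  have xk : ‖X + k1‖ ≤ 2 * (C * R) := (norm_add_le _ _).trans (by linarith)
  have i1 := (abs_le.mp (ip (X + k1) (x2 + X + (X + x0)) 2 4 xk (by
    have e1 := norm_add_le (x2 + X) (X + x0)
    have e2 := norm_add_le x2 X
    have e3 := norm_add_le X x0
    linarith) (by norm_num))).2
  have i2 := (abs_le.mp (ip D X 1 1 (by linarith) (by linarith) (by norm_num))).2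
  have i3 := (abs_le.mp (ip (X + k1) (h1 + h0) 2 2 xk
    ((norm_add_le _ _).trans (by linarith)) (by norm_num))).1
  have i4 := (abs_le.mp (ip D (k2 + k0) 1 2 (by linarith)
    ((norm_add_le _ _).trans (by linarith)) (by norm_num))).2
  have i5 : τ * ‖p‖^2 ≤ g^2 * (C^2 * S) := by
    calc _ ≤ g^2 * ‖δ‖^2 := hp
      _ ≤ g^2 * (C * R)^2 := by gcongr
      _ = _ := by rw [← hRS]; ring
  have j0 : 0 ≤ (ε₀ * τ / (2 * τ₀)) * ‖δ + d‖^2 := by positivity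
  have j1 : τ / (2 * τ₀ * μ₀) * ⟪X + k1, x2 + X + (X + x0)⟫
      ≤ τ / (2 * τ₀ * μ₀) * (2 * 4 * C^2 * S) := by gcongr
  have j2 : 2 * τ / μ₀ * ⟪D, X⟫ ≤ 2 * τ / μ₀ * (1 * 1 * C^2 * S) := by gcongr
  have j3 : (4 * μ₀ / τ₀^2 + 1) * (τ / μ₀) * (-(2 * 2 * C^2 * S))
      ≤ (4 * μ₀ / τ₀^2 + 1) * (τ / μ₀) * ⟪X + k1, h1 + h0⟫ := by gcongr
  have j4 : (2 / μ₀ + 1) * (2 * τ) * ⟪D, k2 + k0⟫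
      ≤ (2 / μ₀ + 1) * (2 * τ) * (1 * 2 * C^2 * S) := by gcongr
  have j5 : σ₀ / (2 * τ₀) * τ * (τ * ‖p‖^2) ≤ σ₀ / (2 * τ₀) * τ * (g^2 * (C^2 * S)) := by gcongr
  have j6 : 0 ≤ σ₀ / (2 * τ₀) * τ^2 * ‖q‖^2 := by positivity
  have fin : C^2 * (σ₀ * g^2 / (2 * τ₀) + 4 / (τ₀ * μ₀) + 2 / μ₀
    + (4 * μ₀ / τ₀^2 + 1) * (4 / μ₀) + 4 * (2 / μ₀ + 1)) * τ * S
    = σ₀ / (2 * τ₀) * τ * (g^2 * (C^2 * S)) + τ / (2 * τ₀ * μ₀) * (2 * 4 * C^2 * S)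
      + 2 * τ / μ₀ * (1 * 1 * C^2 * S) + (4 * μ₀ / τ₀^2 + 1) * (τ / μ₀) * (2 * 2 * C^2 * S)
      + (2 / μ₀ + 1) * (2 * τ) * (1 * 2 * C^2 * S) := by
    field_simp
    ring
  rw [fin]
  linarith

end helpers

/-- Discrete Gronwall inequality. -/
lemma lf_gronwall (L τ : ℝ) (hL : 0 < L) (hτ : 0 < τ) (Φ F : ℕ → ℝ) (hF : ∀ n, 0 ≤ F n)
    (M : ℕ) (hstep : ∀ n, n < M → Φ (n + 1) ≤ (1 + L * τ) * Φ n + L * τ * F (n + 1))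
    (m : ℕ) (hm : m ≤ M) :
    Φ m ≤ (1 + L * τ)^m * (Φ 0 + L * τ * ∑ n ∈ Finset.Icc 1 m, F n) := by
  induction m with
  | zero => simp
  | succ m ih =>
    have ih := ih (by omega)
    have h1 := hstep m (by omega)
    have hp : 1 ≤ (1 + L * τ)^(m+1) := one_le_pow₀ (by nlinarith)
    rw [Finset.sum_Icc_succ_top (by omega)]
    have h2 := mul_le_mul_of_nonneg_left ih (show 0 ≤ 1 + L * τ by positivity)
    have h3 : L * τ * F (m+1) ≤ (1 + L * τ)^(m+1) * (L * τ * F (m+1)) :=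
      le_mul_of_one_le_left (mul_nonneg (by positivity) (hF _)) hp
    calc _ ≤ _ := h1
      _ ≤ (1 + L * τ) * ((1 + L * τ)^m * (Φ 0 + L * τ * ∑ n ∈ Finset.Icc 1 m, F n))
        + (1 + L * τ)^(m+1) * (L * τ * F (m+1)) := by linarith
      _ = _ := by ring

set_option maxHeartbeats 4000000 in
/-- Theorem 3.1, discrete stability of the leapfrog finite
element scheme. There is a constant `C* > 0`, independent of the time step `τ`
and the mesh size `h` (it depends only on `ε₀, μ₀, τ₀, σ₀, C_in, C_tr, T_fin`),
bounding the discrete energy of any solution of the leapfrog scheme under the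
CFL condition. -/
theorem leapfrog_discrete_stability
    (ε₀ μ₀ τ₀ σ₀ Cin Ctr Tfin : ℝ)
    (hε₀ : 0 < ε₀) (hμ₀ : 0 < μ₀) (hτ₀ : 0 < τ₀) (hσ₀ : 0 < σ₀)
    (hCin : 0 < Cin) (hCtr : 0 < Ctr) (hTfin : 0 < Tfin) :
    ∃ Cstar : ℝ, 0 < Cstar ∧
      ∀ (V : Type u) (U : Type v) (Z : Type w)
        [NormedAddCommGroup V] [InnerProductSpace ℝ V]
        [NormedAddCommGroup U] [InnerProductSpace ℝ U]
        [NormedAddCommGroup Z] [InnerProductSpace ℝ Z]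
        (B : V →ₗ[ℝ] U) (T : V →ₗ[ℝ] Z) (h : ℝ), 0 < h →
        (∀ φ : V, ‖B φ‖ ≤ Cin * h⁻¹ * ‖φ‖) →
        (∀ φ : V, ‖T φ‖ ≤ Ctr * (Real.sqrt h)⁻¹ * ‖φ‖) →
        ∀ (Nt : ℕ), 0 < Nt →
        ∀ (τ : ℝ), τ = Tfin / Nt →
        τ ≤ min 1 (min (h / (2 * Cin * (1 / Real.sqrt (ε₀ * μ₀))))
              (min (h * Real.sqrt (ε₀ * τ₀) / (2 * Ctr * Real.sqrt σ₀))
                (min (h * Real.sqrt τ₀ / (Real.sqrt 2 * Cin * (1 / Real.sqrt (ε₀ * μ₀))))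
                  (h * τ₀ / (Cin * (1 / Real.sqrt (ε₀ * μ₀))))))) →
        ∀ (E : ℕ → V) (H K : ℕ → U),
        -- (a) the leapfrog scheme for the electric field, for 1 ≤ n ≤ Nt − 1,
        -- where `H n` stands for the half-step value `H^{n+1/2}`
        (∀ n, 1 ≤ n → n ≤ Nt - 1 → ∀ φ : V,
          ε₀ * ⟪(τ^2)⁻¹ • (E (n+1) - 2 • E n + E (n-1)), φ⟫
            + (ε₀ / τ₀) * ⟪(2*τ)⁻¹ • (E (n+1) - E (n-1)), φ⟫
            + (1 / μ₀) * ⟪B (E n), B φ⟫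
          = (1 / τ₀) * ⟪(2:ℝ)⁻¹ • (H n + H (n-1)), B φ⟫
            - (σ₀ / τ₀) * ⟪T (E n), T φ⟫
            - (1 / μ₀) * ⟪K n, B φ⟫) →
        -- (b) the leapfrog scheme for the magnetic field, for 1 ≤ n ≤ Nt − 1
        (∀ n, 1 ≤ n → n ≤ Nt - 1 → ∀ ψ : U,
          μ₀ * ⟪τ⁻¹ • (H n - H (n-1)), ψ⟫ = -⟪B (E n), ψ⟫ - ⟪K n, ψ⟫) →
        -- conclusion: bound on the discrete energy
        ∀ m, 1 ≤ m → m ≤ Nt - 1 →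
          (ε₀ * ‖τ⁻¹ • (E (m+1) - E m)‖^2
            + (1 / (2 * μ₀)) * (‖B (E (m+1))‖^2 + ‖B (E m)‖^2)
            + μ₀ * ‖H m‖^2
            + (σ₀ / (2 * τ₀)) * (‖T (E (m+1))‖^2 + ‖T (E m)‖^2)
            + (τ / (4 * μ₀ * τ₀)) * (‖B (E (m+1))‖^2 + ‖B (E m)‖^2))
          ≤ Cstar *
            ((ε₀ * ‖τ⁻¹ • (E 1 - E 0)‖^2
              + (1 / (2 * μ₀)) * (‖B (E 1)‖^2 + ‖B (E 0)‖^2)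
              + μ₀ * ‖H 0‖^2
              + (σ₀ / (2 * τ₀)) * (‖T (E 1)‖^2 + ‖T (E 0)‖^2)
              + (τ / (4 * μ₀ * τ₀)) * (‖B (E 1)‖^2 + ‖B (E 0)‖^2))
            + ‖K 0‖^2 + ‖K 1‖^2
            + τ * ∑ n ∈ Finset.Icc 1 m,
                (‖K n‖^2 + ‖(2*τ)⁻¹ • (K (n+1) - K (n-1))‖^2)) := by
  have hβ : 0 < Real.sqrt (ε₀ * μ₀) / 2 := by positivity
  have hβ2 : (Real.sqrt (ε₀ * μ₀) / 2)^2 = ε₀ * μ₀ / 4 := by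
    rw [div_pow, Real.sq_sqrt (by positivity)]; norm_num
  set β := Real.sqrt (ε₀ * μ₀) / 2 with hβdef
  have hc0 : 0 < Real.sqrt (ε₀ * τ₀) / (2 * Ctr * Real.sqrt σ₀) := by positivity
  set cc := Real.sqrt (ε₀ * τ₀) / (2 * Ctr * Real.sqrt σ₀) with hcc
  have hg : 0 < Real.sqrt (Ctr^2 * cc) := by positivity
  have hg2 : (Real.sqrt (Ctr^2 * cc))^2 = Ctr^2 * cc := Real.sq_sqrt (by positivity)
  set g := Real.sqrt (Ctr^2 * cc) with hgdef
  obtain ⟨L, hL, hstep⟩ := lf_step.{u, v, w} ε₀ μ₀ τ₀ σ₀ β g hε₀ hμ₀ hτ₀ hσ₀ hβ hg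
  obtain ⟨c1, hc1, hlow⟩ := lf_lower.{u, v, w} ε₀ μ₀ τ₀ σ₀ β hε₀ hμ₀ hτ₀ hσ₀ hβ hβ2
  obtain ⟨c2, hc2, hup⟩ := lf_upper.{u, v, w} ε₀ μ₀ τ₀ σ₀ hε₀ hμ₀ hτ₀ hσ₀
  have hL' : 0 < L * (1 + 1 / c1) := by positivity
  set L' := L * (1 + 1 / c1) with hL'def
  have hc3 : 0 < ε₀ + 1 / (2 * μ₀) + μ₀ + σ₀ / (2 * τ₀) + 1 / (4 * μ₀ * τ₀) := by positivity
  set c3 := ε₀ + 1 / (2 * μ₀) + μ₀ + σ₀ / (2 * τ₀) + 1 / (4 * μ₀ * τ₀) with hc3def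
  have hc4 : 0 < 1 / ε₀ + 2 * μ₀ + 1 / μ₀ + 2 * τ₀ / σ₀ := by positivity
  set c4 := 1 / ε₀ + 2 * μ₀ + 1 / μ₀ + 2 * τ₀ / σ₀ with hc4def
  refine ⟨c3 / c1 * (Real.exp (L' * Tfin) * (c2 * (c4 + 1) + L')), by positivity, ?_⟩
  intro V U Z _ _ _ _ _ _ B T h hh hBin hTtr Nt hNt τ hτdef hCFL E H K ha hb m hm1 hmN
  have hNt' : (0 : ℝ) < Nt := by exact_mod_cast hNt
  have hτ : 0 < τ := by rw [hτdef]; positivity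
  have hτ1 : τ ≤ 1 := hCFL.trans (min_le_left _ _)
  have hCFL2 : τ ≤ h / (2 * Cin * (1 / Real.sqrt (ε₀ * μ₀))) :=
    hCFL.trans ((min_le_right _ _).trans (min_le_left _ _))
  have hCFL3 : τ ≤ h * Real.sqrt (ε₀ * τ₀) / (2 * Ctr * Real.sqrt σ₀) :=
    hCFL.trans ((min_le_right _ _).trans ((min_le_right _ _).trans (min_le_left _ _)))
  have hBτ : ∀ φ : V, τ * ‖B φ‖ ≤ β * ‖φ‖ := by
    intro φ
    have hs : 0 < Real.sqrt (ε₀ * μ₀) := by positivity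
    calc τ * ‖B φ‖ ≤ (h / (2 * Cin * (1 / Real.sqrt (ε₀ * μ₀)))) * (Cin * h⁻¹ * ‖φ‖) := by
          gcongr; exact hBin φ
      _ = β * ‖φ‖ := by rw [hβdef]; field_simp
  have hTτ : ∀ φ : V, τ * ‖T φ‖^2 ≤ g^2 * ‖φ‖^2 := by
    intro φ
    have hs : (Real.sqrt h)^2 = h := Real.sq_sqrt hh.le
    calc τ * ‖T φ‖^2 ≤ (h * Real.sqrt (ε₀ * τ₀) / (2 * Ctr * Real.sqrt σ₀))
            * (Ctr * (Real.sqrt h)⁻¹ * ‖φ‖)^2 := by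
          gcongr; exact hTtr φ
      _ = (h * cc) * (Ctr^2 * h⁻¹ * ‖φ‖^2) := by
          rw [mul_pow, mul_pow, inv_pow, hs, hcc]; ring
      _ = g^2 * ‖φ‖^2 := by rw [hg2]; field_simp
  set δ : ℕ → V := fun n => τ⁻¹ • (E (n+1) - E n) with hδ
  have hEs : ∀ n, E (n+1) = E n + τ • δ n := by
    intro n
    simp only [hδ, smul_smul, mul_inv_cancel₀ hτ.ne', one_smul]
    abel
  set Φ : ℕ → ℝ := fun n => lfPhi ε₀ μ₀ τ₀ σ₀ τ (δ n) (B (E (n+1))) (B (E n)) (B (δ n)) (H n)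
    (K n) (K (n+1)) (T (E (n+1))) (T (E n)) with hΦ
  set A : ℕ → ℝ := fun n => lfA (δ n) (B (E (n+1))) (B (E n)) (H n)
    (K n) (K (n+1)) (T (E (n+1))) (T (E n)) with hA
  set F : ℕ → ℝ := fun n => ‖K n‖^2 + ‖(2*τ)⁻¹ • (K (n+1) - K (n-1))‖^2 with hF
  have hF0 : ∀ n, 0 ≤ F n := fun n => by simp only [hF]; positivity
  have lowA : ∀ n, c1 * A n ≤ Φ n := fun n => hlow V U Z τ _ _ _ _ _ _ _ _ _ hτ (hBτ _)
  have upA : ∀ n, Φ n ≤ c2 * A n := fun n => hup V U Z τ _ _ _ _ _ _ _ _ _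
  have st : ∀ n, n < Nt - 1 → Φ (n+1) ≤ (1 + L' * τ) * Φ n + L' * τ * F (n+1) := by
    intro n hn
    have ha' := ha (n+1) (by omega) (by omega) (τ • (δ (n+1) + δ n))
    have hb' := hb (n+1) (by omega) (by omega)
    simp only [Nat.add_sub_cancel] at ha' hb'
    have hBstep : H (n+1) = H n - (τ / μ₀) • (B (E (n+1)) + K (n+1)) := by
      have e : μ₀ • (τ⁻¹ • (H (n+1) - H n)) = -(B (E (n+1)) + K (n+1)) := by
        apply ext_inner_right ℝ
        intro ψ
        rw [real_inner_smul_left, hb' ψ, inner_neg_left, inner_add_left]; ring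
      have e2 : (τ / μ₀) • (μ₀ • (τ⁻¹ • (H (n+1) - H n))) = H (n+1) - H n := by
        rw [smul_smul, smul_smul]
        have : τ / μ₀ * μ₀ * τ⁻¹ = 1 := by field_simp
        rw [this, one_smul]
      rw [e] at e2
      rw [smul_neg] at e2
      rw [sub_eq_add_neg, e2]; abel
    have eA : (τ^2)⁻¹ • (E (n+1+1) - 2 • E (n+1) + E n) = τ⁻¹ • (δ (n+1) - δ n) := by
      simp only [hδ]
      rw [← smul_sub, smul_smul, two_smul, ← mul_inv, sq]
      congr 1; abel
    have eB : (2*τ)⁻¹ • (E (n+1+1) - E n) = (2:ℝ)⁻¹ • (δ (n+1) + δ n) := by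
      simp only [hδ]
      rw [← smul_add, smul_smul, ← mul_inv]
      congr 1; abel
    rw [eA, eB] at ha'
    simp only [map_smul, real_inner_smul_left, real_inner_smul_right, map_add] at ha'
    have n1 : ⟪δ (n+1) - δ n, δ (n+1) + δ n⟫ = ‖δ (n+1)‖^2 - ‖δ n‖^2 := by
      simp only [← real_inner_self_eq_norm_sq, inner_add_right, inner_sub_left]
      rw [real_inner_comm (δ n) (δ (n+1))]; ring
    rw [n1, real_inner_self_eq_norm_sq] at ha'
    have ha2 : ε₀ * (‖δ (n+1)‖^2 - ‖δ n‖^2) + (ε₀ * τ / (2 * τ₀)) * ‖δ (n+1) + δ n‖^2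
        + (τ / μ₀) * ⟪B (E (n+1)), B (δ (n+1)) + B (δ n)⟫
        = (τ / (2 * τ₀)) * ⟪H (n+1) + H n, B (δ (n+1)) + B (δ n)⟫
          - (σ₀ * τ / τ₀) * ⟪T (E (n+1)), T (δ (n+1)) + T (δ n)⟫
          - (τ / μ₀) * ⟪K (n+1), B (δ (n+1)) + B (δ n)⟫ := by
      have e : ε₀ * (τ * (τ⁻¹ * (‖δ (n+1)‖^2 - ‖δ n‖^2)))
        = ε₀ * (‖δ (n+1)‖^2 - ‖δ n‖^2) := by field_simp
      linear_combination ha' - e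
    have main := hstep V U Z τ (δ (n+1)) (δ n) (B (E (n+1))) (B (δ (n+1))) (B (δ n)) (H n) (H (n+1))
      (K n) (K (n+1)) ((2*τ)⁻¹ • (K (n+1+1) - K n)) (T (E (n+1))) (T (δ (n+1))) (T (δ n))
      hτ hτ1 (hBτ _) (hBτ _) (hTτ _) (hTτ _) ha2 hBstep
    have f1 : B (E (n+1)) + τ • B (δ (n+1)) = B (E (n+1+1)) := by
      rw [← map_smul, ← map_add, ← hEs (n+1)]
    have f2 : T (E (n+1)) + τ • T (δ (n+1)) = T (E (n+1+1)) := by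
      rw [← map_smul, ← map_add, ← hEs (n+1)]
    have f3 : B (E (n+1)) - τ • B (δ n) = B (E n) := by
      rw [← map_smul, ← map_sub, hEs n, add_sub_cancel_right]
    have f4 : T (E (n+1)) - τ • T (δ n) = T (E n) := by
      rw [← map_smul, ← map_sub, hEs n, add_sub_cancel_right]
    have f5 : K n + (2 * τ) • ((2*τ)⁻¹ • (K (n+1+1) - K n)) = K (n+1+1) := by
      rw [smul_smul, mul_inv_cancel₀ (by positivity), one_smul]; abel
    rw [f1, f2, f3, f4, f5] at main
    change Φ (n+1) ≤ Φ n + L * τ * (A n + F (n+1)) at main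
    have g1 : A n ≤ (1 / c1) * Φ n := by
      have := lowA n
      rw [one_div, inv_mul_eq_div, le_div_iff₀ hc1]; linarith
    have A0 : 0 ≤ A n := by simp only [hA]; unfold lfA; positivity
    have P0 : 0 ≤ Φ n := (mul_nonneg hc1.le A0).trans (lowA n)
    have g2 : L * τ * (A n + F (n+1)) ≤ L * τ * ((1 / c1) * Φ n + F (n+1)) := by gcongr
    have g3 : L' * τ * Φ n = L * τ * ((1 / c1) * Φ n) + L * τ * Φ n := by rw [hL'def]; ring
    have g4 : L' * τ * F (n+1) = L * τ * F (n+1) + L * τ * (1 / c1) * F (n+1) := by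
      rw [hL'def]; ring
    have g5 : 0 ≤ L * τ * Φ n := by positivity
    have g6 : 0 ≤ L * τ * (1 / c1) * F (n+1) := mul_nonneg (by positivity) (hF0 _)
    linarith
  have gr := lf_gronwall L' τ hL' hτ Φ F hF0 (Nt - 1) st m hmN
  have A00 : 0 ≤ A 0 := by simp only [hA]; unfold lfA; positivity
  have P00 : 0 ≤ Φ 0 := (mul_nonneg hc1.le A00).trans (lowA 0)
  have hsum0 : 0 ≤ ∑ n ∈ Finset.Icc 1 m, F n := Finset.sum_nonneg fun n _ => hF0 n
  have hpow : (1 + L' * τ)^m ≤ Real.exp (L' * Tfin) := by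
    have e1 : 1 + L' * τ ≤ Real.exp (L' * τ) := by
      have := Real.add_one_le_exp (L' * τ); linarith
    calc (1 + L' * τ)^m ≤ (Real.exp (L' * τ))^m := by gcongr
      _ = Real.exp (m * (L' * τ)) := by rw [← Real.exp_nat_mul]
      _ ≤ Real.exp (L' * Tfin) := by
        apply Real.exp_le_exp.mpr
        have hmle : (m : ℝ) ≤ Nt := by exact_mod_cast (by omega : m ≤ Nt)
        have : Tfin = Nt * τ := by rw [hτdef]; field_simp
        rw [this]
        have := mul_le_mul_of_nonneg_right hmle (show 0 ≤ L' * τ by positivity)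
        linarith
  set ENG0 := ε₀ * ‖τ⁻¹ • (E 1 - E 0)‖^2
              + (1 / (2 * μ₀)) * (‖B (E 1)‖^2 + ‖B (E 0)‖^2)
              + μ₀ * ‖H 0‖^2
              + (σ₀ / (2 * τ₀)) * (‖T (E 1)‖^2 + ‖T (E 0)‖^2)
              + (τ / (4 * μ₀ * τ₀)) * (‖B (E 1)‖^2 + ‖B (E 0)‖^2) with hENG0
  have t1 : 0 ≤ ε₀ * ‖τ⁻¹ • (E 1 - E 0)‖^2 := by positivity
  have t2 : 0 ≤ (1 / (2 * μ₀)) * (‖B (E 1)‖^2 + ‖B (E 0)‖^2) := by positivity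
  have t3 : 0 ≤ μ₀ * ‖H 0‖^2 := by positivity
  have t4 : 0 ≤ (σ₀ / (2 * τ₀)) * (‖T (E 1)‖^2 + ‖T (E 0)‖^2) := by positivity
  have t5 : 0 ≤ (τ / (4 * μ₀ * τ₀)) * (‖B (E 1)‖^2 + ‖B (E 0)‖^2) := by positivity
  have ENGnn : 0 ≤ ENG0 := by rw [hENG0]; positivity
  have hA0 : A 0 ≤ c4 * ENG0 + ‖K 0‖^2 + ‖K 1‖^2 := by
    have s1 : ‖τ⁻¹ • (E 1 - E 0)‖^2 ≤ 1 / ε₀ * ENG0 := by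
      calc _ = 1 / ε₀ * (ε₀ * ‖τ⁻¹ • (E 1 - E 0)‖^2) := by field_simp
        _ ≤ _ := by gcongr; linarith
    have s2 : ‖B (E 1)‖^2 + ‖B (E 0)‖^2 ≤ 2 * μ₀ * ENG0 := by
      calc _ = 2 * μ₀ * ((1 / (2 * μ₀)) * (‖B (E 1)‖^2 + ‖B (E 0)‖^2)) := by field_simp
        _ ≤ _ := by gcongr; linarith
    have s3 : ‖H 0‖^2 ≤ 1 / μ₀ * ENG0 := by
      calc _ = 1 / μ₀ * (μ₀ * ‖H 0‖^2) := by field_simp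
        _ ≤ _ := by gcongr; linarith
    have s4 : ‖T (E 1)‖^2 + ‖T (E 0)‖^2 ≤ 2 * τ₀ / σ₀ * ENG0 := by
      calc _ = 2 * τ₀ / σ₀ * ((σ₀ / (2 * τ₀)) * (‖T (E 1)‖^2 + ‖T (E 0)‖^2)) := by field_simp
        _ ≤ _ := by gcongr; linarith
    have s5 : c4 * ENG0 = 1 / ε₀ * ENG0 + 2 * μ₀ * ENG0 + 1 / μ₀ * ENG0 + 2 * τ₀ / σ₀ * ENG0 := by
      rw [hc4def]; ring
    rw [s5]
    simp only [hA, hδ, lfA, zero_add]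
    linarith
  have hfin : ε₀ * ‖δ m‖^2
            + (1 / (2 * μ₀)) * (‖B (E (m+1))‖^2 + ‖B (E m)‖^2)
            + μ₀ * ‖H m‖^2
            + (σ₀ / (2 * τ₀)) * (‖T (E (m+1))‖^2 + ‖T (E m)‖^2)
            + (τ / (4 * μ₀ * τ₀)) * (‖B (E (m+1))‖^2 + ‖B (E m)‖^2) ≤ c3 * A m := by
    have n1 := sq_nonneg ‖δ m‖
    have n2 := sq_nonneg ‖B (E (m+1))‖
    have n3 := sq_nonneg ‖B (E m)‖
    have n4 := sq_nonneg ‖H m‖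
    have n5 := sq_nonneg ‖T (E (m+1))‖
    have n6 := sq_nonneg ‖T (E m)‖
    have n7 := sq_nonneg ‖K m‖
    have n8 := sq_nonneg ‖K (m+1)‖
    have s1 : ε₀ * ‖δ m‖^2 ≤ ε₀ * A m := by
      gcongr; simp only [hA, lfA]; linarith
    have s2 : (1 / (2 * μ₀)) * (‖B (E (m+1))‖^2 + ‖B (E m)‖^2) ≤ (1 / (2 * μ₀)) * A m := by
      gcongr; simp only [hA, lfA]; linarith
    have s3 : μ₀ * ‖H m‖^2 ≤ μ₀ * A m := by
      gcongr; simp only [hA, lfA]; linarith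
    have s4 : (σ₀ / (2 * τ₀)) * (‖T (E (m+1))‖^2 + ‖T (E m)‖^2) ≤ (σ₀ / (2 * τ₀)) * A m := by
      gcongr; simp only [hA, lfA]; linarith
    have s5 : (τ / (4 * μ₀ * τ₀)) * (‖B (E (m+1))‖^2 + ‖B (E m)‖^2)
        ≤ (1 / (4 * μ₀ * τ₀)) * A m := by
      gcongr; simp only [hA, lfA]; linarith
    have s6 : c3 * A m = ε₀ * A m + (1 / (2 * μ₀)) * A m + μ₀ * A m + (σ₀ / (2 * τ₀)) * A m
      + (1 / (4 * μ₀ * τ₀)) * A m := by rw [hc3def]; ring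
    linarith
  refine hfin.trans ?_
  set W := ENG0 + ‖K 0‖^2 + ‖K 1‖^2 + τ * ∑ n ∈ Finset.Icc 1 m, F n with hW
  have hτs : 0 ≤ τ * ∑ n ∈ Finset.Icc 1 m, F n := by positivity
  have w1 : Φ 0 + L' * τ * ∑ n ∈ Finset.Icc 1 m, F n ≤ (c2 * (c4 + 1) + L') * W := by
    have v1 : A 0 ≤ (c4 + 1) * W := by
      have k0 := sq_nonneg ‖K 0‖
      have k1 := sq_nonneg ‖K 1‖
      have : c4 * ENG0 ≤ c4 * W := by gcongr; linarith
      linarith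
    have v2 : c2 * A 0 ≤ c2 * ((c4 + 1) * W) := by gcongr
    have v3 : L' * (τ * ∑ n ∈ Finset.Icc 1 m, F n) ≤ L' * W := by
      gcongr
      have k0 := sq_nonneg ‖K 0‖
      have k1 := sq_nonneg ‖K 1‖
      linarith
    have := upA 0
    linarith
  have w2 : Φ m ≤ Real.exp (L' * Tfin) * ((c2 * (c4 + 1) + L') * W) := by
    refine gr.trans ?_
    gcongr
  calc c3 * A m = c3 / c1 * (c1 * A m) := by field_simp
    _ ≤ c3 / c1 * (Real.exp (L' * Tfin) * ((c2 * (c4 + 1) + L') * W)) := by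
      exact mul_le_mul_of_nonneg_left ((lowA m).trans w2) (by positivity)
    _ = _ := by ring
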